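/- Vanishing of the deformed determinant (m = 1): for n ≥ 3 and each j ∈ {2, 3, …, n}, Δ̃(x_1, …, x_{n−2} | z_1, …, z_n) restricted to z_j = z_1 τ^{2n−2} vanishes identically (wherever the denominators are nonzero). -/

import Mathlib

noncomputable section

/-- The `k`-th elementary symmetric polynomial `σ_k(z₁,…,z_N)`. -/
def esymF {N : ℕ} (z : Fin N → ℂ) (k : ℕ) : ℂ :=
  ∑ s ∈ Finset.powersetCard k (Finset.univ : Finset (Fin N)), ∏ i ∈ s, z i

/-- `A_λ(x | z₁,…,z_n) = Σ_{κ=0}^{λ} (-1)^κ x^{λ-κ} (τ^{n(λ-κ)+κ} - τ^{-n(λ-κ)-κ}) σ_κ(z)`,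
with `τ = q⁻¹`. -/
def Acl (q : ℂ) (n lam : ℕ) (x : ℂ) (z : Fin n → ℂ) : ℂ :=
  ∑ κ ∈ Finset.range (lam + 1),
    (-1 : ℂ) ^ κ * x ^ (lam - κ) *
      ((q⁻¹) ^ (n * (lam - κ) + κ) - q ^ (n * (lam - κ) + κ)) * esymF z κ

/-- The function `g(x | z₁ | z₂, …, z_n)` (with `τ = q⁻¹`). -/
def gcl (q : ℂ) (n : ℕ) (hn : 0 < n) (x : ℂ) (z : Fin n → ℂ) : ℂ :=
  z ⟨0, hn⟩ * (q⁻¹) ^ (n + 1) / x *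
    (q ^ 2 * ∏ j ∈ Finset.univ.filter (fun j : Fin n => 0 < (j : ℕ)),
        (x * (q⁻¹) ^ (n - 1) - z j) / (z ⟨0, hn⟩ * (q⁻¹) ^ 2 - z j)
      - (x - z ⟨0, hn⟩ * (q⁻¹) ^ (n - 1)) / (x - z ⟨0, hn⟩ * (q⁻¹) ^ (n + 1)) *
        ∏ j ∈ Finset.univ.filter (fun j : Fin n => 0 < (j : ℕ)),
          (x * q ^ (n - 1) - z j) / (z ⟨0, hn⟩ * (q⁻¹) ^ 2 - z j))

/-- The deformed entries
`Ã_λ(x | z₁, …, z_n) = ((x - z₁τ^{n-1})/(x - z₁τ^{n+1})) A_λ(x | z₁τ^{2n}, z₂, …, z_n)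
  + g(x|z₁|z₂,…,z_n) A_λ(z₁τ^{n+1} | z₁τ^{2n}, z₂, …, z_n)`. -/
def Atl (q : ℂ) (n : ℕ) (hn : 0 < n) (lam : ℕ) (x : ℂ) (z : Fin n → ℂ) : ℂ :=
  (x - z ⟨0, hn⟩ * (q⁻¹) ^ (n - 1)) / (x - z ⟨0, hn⟩ * (q⁻¹) ^ (n + 1)) *
      Acl q n lam x (Function.update z ⟨0, hn⟩ (z ⟨0, hn⟩ * (q⁻¹) ^ (2 * n)))
    + gcl q n hn x z *
      Acl q n lam (z ⟨0, hn⟩ * (q⁻¹) ^ (n + 1))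
        (Function.update z ⟨0, hn⟩ (z ⟨0, hn⟩ * (q⁻¹) ^ (2 * n)))

/-- `Δ̃(x₁,…,x_{n-2} | z₁,…,z_n) = det( Ã_λ(x_μ | z) )_{1 ≤ λ, μ ≤ n-2}`. -/
def Dtl (q : ℂ) (n : ℕ) (hn : 0 < n) (x : Fin (n - 2) → ℂ) (z : Fin n → ℂ) : ℂ :=
  Matrix.det (Matrix.of fun lam μ : Fin (n - 2) => Atl q n hn ((lam : ℕ) + 1) (x μ) z)

/-- Truncated characteristic polynomial. -/
def Pl {n : ℕ} (w : Fin n → ℂ) (l : ℕ) (y : ℂ) : ℂ :=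
  ∑ κ ∈ Finset.range (l + 1), (-1 : ℂ) ^ κ * esymF w κ * y ^ (l - κ)

theorem Pl_zero {n : ℕ} (w : Fin n → ℂ) (y : ℂ) : Pl w 0 y = 1 := by
  simp [Pl, esymF]

theorem Pl_succ {n : ℕ} (w : Fin n → ℂ) (l : ℕ) (y : ℂ) :
    Pl w (l + 1) y = y * Pl w l y + (-1) ^ (l + 1) * esymF w (l + 1) := by
  unfold Pl
  rw [Finset.sum_range_succ, Finset.mul_sum]
  congr 1
  · refine Finset.sum_congr rfl fun κ hκ => ?_
    have : l + 1 - κ = (l - κ) + 1 := by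
      have := Finset.mem_range.1 hκ
      omega
    rw [this, pow_succ]
    ring
  · simp

theorem Pl_full {n : ℕ} (w : Fin n → ℂ) (y : ℂ) : Pl w n y = ∏ i, (y - w i) := by
  have h := Multiset.prod_X_sub_X_eq_sum_esymm (Finset.univ.val.map w)
  have h2 := congrArg (Polynomial.eval y) h
  simp only [Multiset.map_map, Multiset.card_map, Finset.card_val, Finset.card_univ,
    Fintype.card_fin, Polynomial.eval_finsetSum, Finset.esymm_map_val] at h2
  unfold Pl esymF
  have h3 : (Multiset.map ((fun t ↦ Polynomial.X - Polynomial.C t) ∘ w) Finset.univ.val).prod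
      = ∏ i, (Polynomial.X - Polynomial.C (w i)) := rfl
  rw [h3, Polynomial.eval_prod] at h2
  simp only [Polynomial.eval_sub, Polynomial.eval_X, Polynomial.eval_C] at h2
  rw [h2]
  refine Finset.sum_congr rfl fun κ _ => ?_
  rw [show ((-1 : Polynomial ℂ)) = Polynomial.C (-1) by simp, ← Polynomial.C_pow]
  simp only [Polynomial.eval_mul, Polynomial.eval_C, Polynomial.eval_pow, Polynomial.eval_X]
  ring

/-- Divided difference. -/
def Gl {n : ℕ} (w : Fin n → ℂ) (y t : ℂ) (m : ℕ) : ℂ :=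
  ∑ l ∈ Finset.range m, t ^ (m - 1 - l) * Pl w l y

theorem Gl_succ {n : ℕ} (w : Fin n → ℂ) (y t : ℂ) (m : ℕ) :
    Gl w y t (m + 1) = t * Gl w y t m + Pl w m y := by
  unfold Gl
  rw [Finset.sum_range_succ, Finset.mul_sum]
  congr 1
  · refine Finset.sum_congr rfl fun κ hκ => ?_
    have : m + 1 - 1 - κ = (m - 1 - κ) + 1 := by
      have := Finset.mem_range.1 hκ
      omega
    rw [this, pow_succ]
    ring
  · simp

theorem Gl_mul {n : ℕ} (w : Fin n → ℂ) (y t : ℂ) (m : ℕ) :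
    (y - t) * Gl w y t m = Pl w m y - Pl w m t := by
  induction m with
  | zero => simp [Gl, Pl_zero]
  | succ m ih =>
    rw [Gl_succ, Pl_succ, Pl_succ]
    linear_combination t * ih

theorem Gl_root {n : ℕ} (w : Fin n → ℂ) (i : Fin n) (y : ℂ) :
    Gl w y (w i) n = ∏ k ∈ Finset.univ.erase i, (y - w k) := by
  have hc : (fun y => Gl w y (w i) n) = fun y => ∏ k ∈ Finset.univ.erase i, (y - w k) := by
    refine Continuous.ext_on (s := {w i}ᶜ) (dense_compl_singleton (w i)) ?_ ?_ ?_
    · unfold Gl Pl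
      fun_prop
    · fun_prop
    · intro y hy
      have hne : y - w i ≠ 0 := sub_ne_zero.2 hy
      have h := Gl_mul w y (w i) n
      have h0 : Pl w n (w i) = 0 := by
        rw [Pl_full]
        exact Finset.prod_eq_zero (Finset.mem_univ i) (sub_self _)
      rw [h0, Pl_full, ← Finset.mul_prod_erase _ _ (Finset.mem_univ i), sub_zero] at h
      exact mul_left_cancel₀ hne h
  exact congrFun hc y

theorem Acl_eq {q : ℂ} {n : ℕ} (hn : 1 ≤ n) (l : ℕ) (x : ℂ) (w : Fin n → ℂ) :
    Acl q n l x w = (q⁻¹) ^ l * Pl w l (x * (q⁻¹) ^ (n - 1))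
      - q ^ l * Pl w l (x * q ^ (n - 1)) := by
  unfold Acl Pl
  rw [Finset.mul_sum, Finset.mul_sum, ← Finset.sum_sub_distrib]
  refine Finset.sum_congr rfl fun κ hκ => ?_
  have : n * (l - κ) + κ = (n - 1) * (l - κ) + l := by
    have := Finset.mem_range.1 hκ
    obtain ⟨d, rfl⟩ : ∃ d, l = κ + d := ⟨l - κ, by omega⟩
    obtain ⟨e, rfl⟩ : ∃ e, n = e + 1 := ⟨n - 1, by omega⟩
    simp
    ring
  rw [this, pow_add, pow_add, pow_mul, pow_mul, mul_pow, mul_pow]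
  ring

theorem Acl_last {q : ℂ} (hq : q ≠ 0) {m : ℕ} (x : ℂ) (w : Fin (m + 1) → ℂ) :
    x * Acl q (m + 1) m x w = ∏ i, (x * (q⁻¹) ^ m - w i) - ∏ i, (x * q ^ m - w i) := by
  rw [Acl_eq (by omega), ← Pl_full, ← Pl_full, Pl_succ, Pl_succ]
  simp only [Nat.add_sub_cancel]
  ring

theorem Acl_sum {q : ℂ} (hq : q ≠ 0) {m : ℕ} (x t : ℂ) (w : Fin (m + 1) → ℂ) :
    ∑ l ∈ Finset.range (m + 1), t ^ (m - l) * Acl q (m + 1) l x w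
      = (q⁻¹) ^ m * Gl w (x * (q⁻¹) ^ m) (t * q) (m + 1)
        - q ^ m * Gl w (x * q ^ m) (t * q⁻¹) (m + 1) := by
  unfold Gl
  rw [Finset.mul_sum, Finset.mul_sum, ← Finset.sum_sub_distrib]
  refine Finset.sum_congr rfl fun l hl => ?_
  rw [Acl_eq (by omega)]
  simp only [Nat.add_sub_cancel]
  obtain ⟨d, rfl⟩ : ∃ d, m = l + d := ⟨m - l, by have := Finset.mem_range.1 hl; omega⟩
  have h1 : (q⁻¹) ^ d * q ^ d = 1 := by rw [← mul_pow, inv_mul_cancel₀ hq, one_pow]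
  simp only [Nat.add_sub_cancel_left, mul_pow]
  generalize Pl w l (x * (q⁻¹) ^ (l + d)) = u
  generalize Pl w l (x * q ^ (l + d)) = v
  rw [pow_add, pow_add]
  linear_combination (-(t ^ d * (q⁻¹) ^ l * u) + t ^ d * q ^ l * v) * h1

/-- The combination of the rows. -/
def Bl (q : ℂ) (m : ℕ) (t x : ℂ) (w : Fin (m + 2) → ℂ) : ℂ :=
  ∑ l : Fin m, t ^ (m - (l : ℕ)) * Acl q (m + 2) ((l : ℕ) + 1) x w

theorem Bl_eq {q : ℂ} (m : ℕ) (t x : ℂ) (w : Fin (m + 2) → ℂ) :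
    Bl q m t x w = ∑ l ∈ Finset.range (m + 2), t ^ (m + 1 - l) * Acl q (m + 2) l x w
      - Acl q (m + 2) (m + 1) x w := by
  rw [Finset.sum_range_succ, Finset.sum_range_succ']
  have h0 : Acl q (m + 2) 0 x w = 0 := by simp [Acl]
  unfold Bl
  rw [Fin.sum_univ_eq_sum_range (fun l => t ^ (m - l) * Acl q (m + 2) (l + 1) x w), h0]
  simp

theorem Bl_key {q : ℂ} (hq : q ≠ 0) (m : ℕ) (t x : ℂ) (w : Fin (m + 2) → ℂ) (j : Fin (m + 2))
    (hj : j ≠ 0) (h0 : w 0 = t * q⁻¹) (h1 : w j = t * q) (S : ℂ → ℂ)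
    (hS : S = fun y => ∏ k ∈ (Finset.univ.erase 0).erase j, (y - w k)) :
    x * Bl q m t x w =
      x * ((q⁻¹) ^ (m + 1) * ((x * (q⁻¹) ^ (m + 1) - w 0) * S (x * (q⁻¹) ^ (m + 1)))
        - q ^ (m + 1) * ((x * q ^ (m + 1) - w j) * S (x * q ^ (m + 1))))
      - ((x * (q⁻¹) ^ (m + 1) - w 0) * ((x * (q⁻¹) ^ (m + 1) - w j) * S (x * (q⁻¹) ^ (m + 1)))
        - (x * q ^ (m + 1) - w 0) * ((x * q ^ (m + 1) - w j) * S (x * q ^ (m + 1)))) := by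
  have hQ : ∀ y, ∏ k ∈ Finset.univ.erase 0, (y - w k) = (y - w j) * S y := by
    intro y
    rw [hS, ← Finset.mul_prod_erase _ _ (Finset.mem_erase.2 ⟨hj, Finset.mem_univ j⟩)]
  have hP : ∀ y, ∏ k, (y - w k) = (y - w 0) * ((y - w j) * S y) := by
    intro y
    rw [← hQ, ← Finset.mul_prod_erase _ _ (Finset.mem_univ (0 : Fin (m + 2)))]
  have hJ : ∀ y, ∏ k ∈ Finset.univ.erase j, (y - w k) = (y - w 0) * S y := by
    intro y
    rw [← Finset.mul_prod_erase _ _ (Finset.mem_erase.2 ⟨hj.symm, Finset.mem_univ 0⟩), hS,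
      Finset.erase_right_comm]
  rw [Bl_eq, mul_sub, Acl_last hq, Acl_sum hq, hP, hP]
  rw [← h1, ← h0, Gl_root, Gl_root, hJ, hQ]

/-- vanishing of the deformed determinant (`m = 1`): for `n ≥ 3`
and each `j ∈ {2, …, n}`, `Δ̃(x₁,…,x_{n-2} | z₁,…,z_n)` vanishes on
`z_j = z₁ τ^{2n-2}` (wherever the denominators are nonzero). -/
theorem Dtl_vanishing (n : ℕ) (hn : 3 ≤ n) (q : ℂ) (hq : q ≠ 0)
    (x : Fin (n - 2) → ℂ) (hx : ∀ μ, x μ ≠ 0)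
    (z : Fin n → ℂ) (j : Fin n) (hj : 0 < (j : ℕ))
    (hzj : z j = z ⟨0, by omega⟩ * (q⁻¹) ^ (2 * n - 2))
    (hd1 : ∀ μ, x μ - z ⟨0, by omega⟩ * (q⁻¹) ^ (n + 1) ≠ 0)
    (hd2 : ∀ i : Fin n, 0 < (i : ℕ) → z ⟨0, by omega⟩ * (q⁻¹) ^ 2 - z i ≠ 0) :
    Dtl q n (by omega) x z = 0 := by
  obtain ⟨m, rfl⟩ : ∃ m, n = m + 2 := ⟨n - 2, by omega⟩
  have hm : 0 < m := by omega
  set z0 : ℂ := z ⟨0, by omega⟩ with hz0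
  have hT : q⁻¹ ≠ 0 := inv_ne_zero hq
  have hj0 : j ≠ 0 := by
    rintro rfl
    simp at hj
  have hz0ne : z0 ≠ 0 := by
    intro h
    apply hd2 j hj
    rw [hzj, h]
    simp
  set t : ℂ := z0 * (q⁻¹) ^ (2 * (m + 2) - 1) with ht
  have htne : t ≠ 0 := mul_ne_zero hz0ne (pow_ne_zero _ hT)
  set w : Fin (m + 2) → ℂ :=
    Function.update z ⟨0, by omega⟩ (z0 * (q⁻¹) ^ (2 * (m + 2))) with hw
  have hw0 : w 0 = z0 * (q⁻¹) ^ (2 * (m + 2)) := by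
    rw [hw]
    exact Function.update_self _ _ _
  have hwk : ∀ k : Fin (m + 2), k ≠ 0 → w k = z k := by
    intro k hk
    rw [hw]
    exact Function.update_of_ne hk _ _
  have h0 : w 0 = t * q⁻¹ := by
    rw [hw0, ht, mul_assoc, ← pow_succ]
    congr 2
  have h1 : w j = t * q := by
    rw [hwk j hj0, hzj, ht]
    have : 2 * (m + 2) - 1 = (2 * (m + 2) - 2) + 1 := by omega
    rw [this, pow_succ]
    field_simp
  obtain ⟨S, hS⟩ : ∃ S : ℂ → ℂ,
    S = fun y => ∏ k ∈ (Finset.univ.erase 0).erase j, (y - w k) := ⟨_, rfl⟩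
  have hfil : Finset.univ.filter (fun j : Fin (m + 2) => 0 < (j : ℕ)) = Finset.univ.erase 0 := by
    ext k
    simp only [Finset.mem_filter, Finset.mem_univ, true_and, Finset.mem_erase, and_true, ne_eq]
    rw [Fin.ext_iff, Nat.pos_iff_ne_zero]
    rfl
  have hQ : ∀ y, ∏ k ∈ Finset.univ.erase 0, (y - z k) = (y - z j) * S y := by
    intro y
    rw [hS, ← Finset.mul_prod_erase _ _ (Finset.mem_erase.2 ⟨hj0, Finset.mem_univ j⟩)]
    congr 1
    refine Finset.prod_congr rfl fun k hk => ?_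
    rw [hwk k (Finset.mem_erase.1 (Finset.mem_erase.1 hk).2).1]
  have key := fun x => Bl_key hq m t x w j hj0 h0 h1 S hS
  have hQ0 : (z0 * (q⁻¹) ^ 2 - z j) * S (z0 * (q⁻¹) ^ 2) ≠ 0 := by
    rw [← hQ]
    refine Finset.prod_ne_zero_iff.2 fun k hk => hd2 k ?_
    have := (Finset.mem_erase.1 hk).1
    exact Nat.pos_of_ne_zero fun h => this (Fin.ext h)
  refine Matrix.exists_vecMul_eq_zero_iff.1 ⟨fun l => t ^ (m - (l : ℕ)), ?_, ?_⟩
  · intro h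
    exact pow_ne_zero _ htne (congrFun h ⟨0, hm⟩)
  · funext μ
    have hsum : (Matrix.vecMul (fun l : Fin (m + 2 - 2) => t ^ (m - (l : ℕ)))
        (Matrix.of fun lam μ : Fin (m + 2 - 2) => Atl q (m + 2) (by omega) ((lam : ℕ) + 1) (x μ) z)) μ
        = (x μ - z0 * (q⁻¹) ^ (m + 1)) / (x μ - z0 * (q⁻¹) ^ (m + 3)) * Bl q m t (x μ) w
          + gcl q (m + 2) (by omega) (x μ) z * Bl q m t (z0 * (q⁻¹) ^ (m + 3)) w := by
      unfold Bl
      rw [Finset.mul_sum, Finset.mul_sum, ← Finset.sum_add_distrib]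
      simp only [Matrix.vecMul, dotProduct]
      refine Finset.sum_congr rfl fun l _ => ?_
      simp only [Matrix.of_apply, Atl]
      rw [← hz0, ← hw]
      have e1 : m + 2 - 1 = m + 1 := rfl
      have e2 : m + 2 + 1 = m + 3 := rfl
      rw [e1, e2]
      ring
    rw [hsum]
    have hg : gcl q (m + 2) (by omega) (x μ) z = z0 * (q⁻¹) ^ (m + 3) / x μ *
        (q ^ 2 * (((x μ * (q⁻¹) ^ (m + 1) - z j) * S (x μ * (q⁻¹) ^ (m + 1))) /
            ((z0 * (q⁻¹) ^ 2 - z j) * S (z0 * (q⁻¹) ^ 2)))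
          - (x μ - z0 * (q⁻¹) ^ (m + 1)) / (x μ - z0 * (q⁻¹) ^ (m + 3)) *
            (((x μ * q ^ (m + 1) - z j) * S (x μ * q ^ (m + 1))) /
            ((z0 * (q⁻¹) ^ 2 - z j) * S (z0 * (q⁻¹) ^ 2)))) := by
      unfold gcl
      rw [hfil, Finset.prod_div_distrib, Finset.prod_div_distrib, hQ, hQ, ← hz0, hQ]
      rfl
    rw [hg]
    have hxμ := hx μ
    have hdμ : x μ - z0 * (q⁻¹) ^ (m + 3) ≠ 0 := hd1 μ
    have kx := key (x μ)
    have k0 := key (z0 * (q⁻¹) ^ (m + 3))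
    have e0 : z0 * (q⁻¹) ^ (m + 3) * q ^ (m + 1) = z0 * (q⁻¹) ^ 2 := by
      have : (q⁻¹) ^ (m + 1) * q ^ (m + 1) = 1 := by
        rw [← mul_pow, inv_mul_cancel₀ hq, one_pow]
      rw [show m + 3 = (m + 1) + 2 from rfl, pow_add]
      linear_combination z0 * (q⁻¹) ^ 2 * this
    have e1 : z0 * (q⁻¹) ^ (m + 3) * (q⁻¹) ^ (m + 1) = w 0 := by
      rw [hw0, mul_assoc, ← pow_add]
      congr 2
      ring
    rw [e0, e1] at k0
    have hwj : w j = z0 * ((q⁻¹) ^ (m + 1)) ^ 2 := by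
      rw [hwk j hj0, hzj, ← pow_mul]
      congr 2
      omega
    have hzj' : z j = z0 * ((q⁻¹) ^ (m + 1)) ^ 2 := by rw [← hwj, hwk j hj0]
    have hw0' : w 0 = z0 * ((q⁻¹) ^ (m + 1)) ^ 2 * (q⁻¹) ^ 2 := by
      rw [hw0, ← pow_mul, mul_assoc, ← pow_add]
      congr 2
      ring
    have hqa : q ^ (m + 1) = ((q⁻¹) ^ (m + 1))⁻¹ := by rw [inv_pow, inv_inv]
    have hp3 : (q⁻¹) ^ (m + 3) = (q⁻¹) ^ (m + 1) * (q⁻¹) ^ 2 := by rw [← pow_add]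
    rw [hp3] at k0 hdμ ⊢
    rw [hwj, hw0'] at kx k0
    rw [hzj'] at hQ0 ⊢
    rw [hqa] at kx k0 ⊢
    clear hqa hp3 e0 e1 hg hsum key hd1 hd2
    clear_value z0
    have ha : (q⁻¹) ^ (m + 1) ≠ 0 := pow_ne_zero _ hT
    generalize (q⁻¹) ^ (m + 1) = a at *
    have hSS : S (z0 * (q⁻¹) ^ 2) ≠ 0 := right_ne_zero_of_mul hQ0
    have hSL : z0 * (q⁻¹) ^ 2 - z0 * a ^ 2 ≠ 0 := left_ne_zero_of_mul hQ0
    generalize S (z0 * (q⁻¹) ^ 2) = S0 at *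
    generalize S (x μ * a) = Sp at *
    generalize S (x μ * a⁻¹) = Sm at *
    generalize S (z0 * a ^ 2 * (q⁻¹) ^ 2) = S1 at *
    generalize Bl q m t (x μ) w = BX at *
    generalize Bl q m t (z0 * (a * (q⁻¹) ^ 2)) w = B0 at *
    generalize x μ = X at *
    have hq2 : q ^ 2 = ((q⁻¹) ^ 2)⁻¹ := by rw [inv_pow, inv_inv]
    rw [hq2]
    clear hq2
    have hb : (q⁻¹) ^ 2 ≠ 0 := pow_ne_zero _ hT
    generalize (q⁻¹) ^ 2 = b at *
    have kx' : BX = (X * BX) / X := by field_simp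
    have hy : z0 * (a * b) ≠ 0 := mul_ne_zero hz0ne (mul_ne_zero ha hb)
    have k0' : B0 = (z0 * (a * b) * B0) / (z0 * (a * b)) := by field_simp
    rw [kx', k0', kx, k0]
    show _ = (0 : ℂ)
    have hSL2 : b - a ^ 2 ≠ 0 := by
      intro h
      apply hSL
      linear_combination z0 * h
    clear kx k0 kx' k0'
    rw [← mul_assoc] at hdμ
    have hdμ2 : X - a * z0 * b ≠ 0 := by rwa [mul_comm a z0]
    have hdμ3 : X - z0 * b * a ≠ 0 := by rwa [mul_right_comm]
    rw [← mul_assoc z0 a b]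
    field_simp
    ring
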